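/- For every integer k ≥ 1 and every real number t ≠ 0, 1/(1 - e^{-t})^k = ∑_{i=1}^{k} a_{k,i-1} · g^{(i-1)}(t), where g^{(i-1)}(t) denotes the (i-1)-th derivative at t of the function g(t) = 1/(1 - e^{-t}), and where the rational coefficients a_{k,i-1} are given by the determinant formula a_{k,i-1} = (-1)^{i+1} · det M(k,i). -/

import Mathlib

/-- The Stirling numbers of the second kind, via the explicit formula. -/
def S (n m : ℕ) : ℚ :=
  (1 / (m.factorial : ℚ)) *
    ∑ ℓ ∈ Finset.range (m + 1), (-1 : ℚ) ^ (m - ℓ) * (m.choose ℓ : ℚ) * (ℓ : ℚ) ^ n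

/-- The `(k-i+1) × (k-i+1)` matrix `M(k,i)`: for `r c : Fin (k-i+1)` (zero-indexed, so the
row is `r+1` and the column `c+1` in the one-indexed description), the first-column entry
is `(1/(i+r-1)!) ⬝ C(k, i+r)` and the entry in a later column `c` is `S(i+c, i+r)`. -/
def M (k i : ℕ) : Matrix (Fin (k - i + 1)) (Fin (k - i + 1)) ℚ := fun r c =>
  if c.val = 0 then (1 / ((i + r.val - 1).factorial : ℚ)) * (k.choose (i + r.val) : ℚ)
  else S (i + c.val) (i + r.val)

/-- The coefficient `a_{k,i-1} = (-1)^{i+1} det M(k,i)`; here `a k i` stands for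
the quantity denoted `a_{k,i-1}` (so `i` runs from `1` to `k`). -/
def a (k i : ℕ) : ℚ := (-1 : ℚ) ^ (i + 1) * (M k i).det

lemma S_zero_zero : S 0 0 = 1 := by simp [S]

lemma S_zero_succ (m : ℕ) : S 0 (m + 1) = 0 := by
  unfold S
  have h := Int.alternating_sum_range_choose_of_ne (n := m + 1) (by omega)
  have h2 : ∑ l ∈ Finset.range (m + 1 + 1), (-1 : ℚ) ^ (m + 1 - l) * ((m + 1).choose l : ℚ) * (l : ℚ) ^ 0 = 0 := by
    rw [← Finset.sum_range_reflect]
    have h3 : ∑ l ∈ Finset.range (m + 1 + 1), ((-1 : ℚ) ^ l * ((m + 1).choose l : ℚ)) = 0 := by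
      exact_mod_cast h
    rw [← h3]
    apply Finset.sum_congr rfl
    intro j hj
    have hj' : j ≤ m + 1 := by simpa [Nat.lt_succ_iff] using hj
    have e1 : m + 1 - (m + 1 + 1 - 1 - j) = j := by omega
    have e2 : m + 1 + 1 - 1 - j = m + 1 - j := by omega
    rw [e1, e2, Nat.choose_symm hj']
    simp
  rw [h2, mul_zero]

lemma S_succ_zero (n : ℕ) : S (n + 1) 0 = 0 := by simp [S]

lemma S_succ_succ (n m : ℕ) : S (n + 1) (m + 1) = (m + 1) * S n (m + 1) + S n m := by
  have hm : ((m.factorial : ℕ) : ℚ) ≠ 0 := by exact_mod_cast m.factorial_ne_zero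
  have key : ∑ l ∈ Finset.range (m + 1 + 1), (-1 : ℚ) ^ (m + 1 - l) * ((m + 1).choose l : ℚ) * (l : ℚ) ^ (n + 1)
      = (m + 1) * ∑ l ∈ Finset.range (m + 1 + 1), (-1 : ℚ) ^ (m + 1 - l) * ((m + 1).choose l : ℚ) * (l : ℚ) ^ n
      + (m + 1) * ∑ l ∈ Finset.range (m + 1), (-1 : ℚ) ^ (m - l) * (m.choose l : ℚ) * (l : ℚ) ^ n := by
    rw [Finset.sum_range_succ, Finset.sum_range_succ _ (m + 1), mul_add, Finset.mul_sum, Finset.mul_sum]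
    have : ∀ l ∈ Finset.range (m + 1), (-1 : ℚ) ^ (m + 1 - l) * ((m + 1).choose l : ℚ) * (l : ℚ) ^ (n + 1)
      = (m + 1) * ((-1 : ℚ) ^ (m + 1 - l) * ((m + 1).choose l : ℚ) * (l : ℚ) ^ n) + 
        (m + 1) * ((-1 : ℚ) ^ (m - l) * (m.choose l : ℚ) * (l : ℚ) ^ n) := by
      intro l hl
      have hl' : l ≤ m := by simpa [Nat.lt_succ_iff] using hl
      obtain ⟨d, rfl⟩ := Nat.exists_eq_add_of_le hl'
      have h := Nat.choose_mul_succ_eq (l + d) l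
      have e1 : l + d + 1 - l = d + 1 := by omega
      have e2 : l + d - l = d := by omega
      rw [e1] at h
      rw [e1, e2]
      have h' : ((l + d).choose l : ℚ) * (l + d + 1) = ((l + d + 1).choose l : ℚ) * (d + 1) := by
        exact_mod_cast h
      push_cast
      rw [pow_succ, pow_succ]
      linear_combination (-(-1 : ℚ) ^ d * (l : ℚ) ^ n) * h'
    rw [Finset.sum_congr rfl this, Finset.sum_add_distrib]
    push_cast
    simp
    ring
  unfold S
  rw [key, Nat.factorial_succ]
  push_cast
  have : (m : ℚ) + 1 ≠ 0 := by positivity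
  field_simp

lemma S_eq (n m : ℕ) : S n m = Nat.stirlingSecond n m := by
  induction n generalizing m with
  | zero => cases m with
    | zero => simp [S_zero_zero]
    | succ m => simp [S_zero_succ]
  | succ n ih => cases m with
    | zero => simp [S_succ_zero]
    | succ m => rw [S_succ_succ, ih, ih, Nat.stirlingSecond_succ_succ]; push_cast; ring

def lah (k m : ℕ) : ℚ := ∑ j ∈ Finset.range (k + 1), (Nat.stirlingFirst k j : ℚ) * S j m

lemma lah_rec (k m : ℕ) : lah (k + 1) (m + 1) = (k + m + 1) * lah k (m + 1) + lah k m := by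
  unfold lah
  rw [Finset.sum_range_succ']
  have h0 : ((Nat.stirlingFirst (k+1) 0 : ℕ) : ℚ) * S 0 (m + 1) = 0 := by rw [S_zero_succ, mul_zero]
  rw [h0, add_zero]
  have h1 : ∑ j ∈ Finset.range (k + 1), (Nat.stirlingFirst k (j + 1) : ℚ) * S (j + 1) (m + 1)
      = ∑ j ∈ Finset.range (k + 1), (Nat.stirlingFirst k j : ℚ) * S j (m + 1) := by
    rw [Finset.sum_range_succ, Finset.sum_range_succ' _ k,
      Nat.stirlingFirst_eq_zero_of_lt (Nat.lt_succ_self k), S_zero_succ]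
    simp
  have h2 : ∀ j ∈ Finset.range (k + 1), (Nat.stirlingFirst (k + 1) (j + 1) : ℚ) * S (j + 1) (m + 1)
     = k * ((Nat.stirlingFirst k (j + 1) : ℚ) * S (j + 1) (m + 1))
       + ((m + 1) * ((Nat.stirlingFirst k j : ℚ) * S j (m + 1)) + (Nat.stirlingFirst k j : ℚ) * S j m) := by
    intro j _
    rw [Nat.stirlingFirst_succ_succ]
    push_cast
    rw [add_mul, mul_assoc]
    congr 1
    rw [S_succ_succ]; ring
  rw [Finset.sum_congr rfl h2, Finset.sum_add_distrib, Finset.sum_add_distrib, ← Finset.mul_sum,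
    ← Finset.mul_sum, h1]
  ring

lemma lah_zero (k : ℕ) : lah (k + 1) 0 = 0 := by
  unfold lah
  rw [Finset.sum_range_succ']
  simp [S_succ_zero]

lemma lah_eq (k m : ℕ) :
    lah (k + 1) (m + 1) = k.factorial / m.factorial * ((k + 1).choose (m + 1) : ℚ) := by
  induction k generalizing m with
  | zero =>
    rw [lah_rec]
    cases m with
    | zero => simp [lah, S_zero_succ, S_zero_zero]
    | succ m => simp [lah, S_zero_succ, Nat.choose_eq_zero_of_lt]
  | succ k ih =>
    rw [lah_rec]
    cases m with
    | zero =>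
      rw [lah_zero, ih, Nat.factorial_succ]
      push_cast
      simp
      ring
    | succ m =>
      rw [ih, ih, Nat.choose_succ_succ (k + 1) (m + 1), Nat.factorial_succ k, Nat.factorial_succ m]
      have h := Nat.choose_succ_right_eq (k + 1) (m + 1)
      have hm : ((m.factorial : ℕ) : ℚ) ≠ 0 := by exact_mod_cast m.factorial_ne_zero
      have hm' : (m : ℚ) + 1 ≠ 0 := by positivity
      have h' : ((k + 1).choose (m + 2) : ℚ) * (m + 2) = ((k + 1).choose (m + 1) : ℚ) * (k - m) := by
        rcases le_or_gt m k with hmk | hmk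
        · obtain ⟨d, rfl⟩ := Nat.exists_eq_add_of_le hmk
          have e : m + d + 1 - (m + 1) = d := by omega
          rw [e] at h
          push_cast
          have : ((m : ℚ) + d - m) = d := by ring
          rw [this]
          exact_mod_cast h
        · rw [Nat.choose_eq_zero_of_lt (by omega), Nat.choose_eq_zero_of_lt (by omega)]; simp
      push_cast
      field_simp
      simp only [Nat.succ_eq_add_one, show m + 1 + 1 = m + 2 from rfl]
      linear_combination h'

lemma det_M (k i : ℕ) (hi : 1 ≤ i) (hik : i ≤ k) :
    (M k i).det = (Nat.stirlingFirst k i : ℚ) / (k - 1).factorial := by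
  let A : Matrix (Fin (k - i + 1)) (Fin (k - i + 1)) ℚ := fun r c => S (i + c.val) (i + r.val)
  let y : Fin (k - i + 1) → ℚ := fun c => (Nat.stirlingFirst k (i + c.val) : ℚ) / (k - 1).factorial
  have hA : A.det = 1 := by
    rw [Matrix.det_of_isUpperTriangular]
    · apply Finset.prod_eq_one
      intro j _
      simp [A, S_eq, Nat.stirlingSecond_self]
    · intro r c h
      have h' : c.val < r.val := h
      simp only [A, S_eq]
      rw [Nat.stirlingSecond_eq_zero_of_lt (by omega)]; simp
  have hM : M k i = A.updateCol 0 (A.mulVec y) := by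
    ext r c
    rw [Matrix.updateCol_apply]
    unfold M
    by_cases hc : c = 0
    · subst hc
      simp only [Fin.val_zero, if_true]
      obtain ⟨m, hm⟩ : ∃ m, i + r.val = m + 1 := ⟨i + r.val - 1, by omega⟩
      obtain ⟨n, rfl⟩ : ∃ n, k = n + 1 := ⟨k - 1, by omega⟩
      have hL := lah_eq n m
      have hsum : A.mulVec y r = lah (n + 1) (m + 1) / n.factorial := by
        simp only [Matrix.mulVec, dotProduct, A, y, lah, hm]
        rw [Fin.sum_univ_eq_sum_range (fun c => S (i + c) (m + 1) * ((Nat.stirlingFirst (n + 1) (i + c) : ℚ) / (n + 1 - 1).factorial))]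
        have e : n + 1 + 1 = i + (n + 1 - i + 1) := by omega
        rw [e, Finset.sum_range_add _ i, Finset.sum_eq_zero (s := Finset.range i), zero_add, Finset.sum_div]
        · apply Finset.sum_congr rfl
          intro c _
          simp only [Nat.add_sub_cancel]
          ring
        · intro j hj
          have : j < i := by simpa using hj
          rw [S_eq, Nat.stirlingSecond_eq_zero_of_lt (by omega)]; simp
      rw [hsum, hL, hm, Nat.add_sub_cancel]
      have hn : ((n.factorial : ℕ) : ℚ) ≠ 0 := by exact_mod_cast n.factorial_ne_zero
      field_simp
    · have : c.val ≠ 0 := fun h => hc (Fin.ext h)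
      simp [hc, this, A]
  rw [hM, ← Matrix.cramer_apply, Matrix.cramer_eq_adjugate_mulVec, Matrix.mulVec_mulVec,
    Matrix.adjugate_mul, hA]
  simp [y]

noncomputable def gg (s : ℝ) : ℝ := 1 / (1 - Real.exp (-s))

lemma den_ne {t : ℝ} (ht : t ≠ 0) : 1 - Real.exp (-t) ≠ 0 := by
  intro h
  have : Real.exp (-t) = 1 := by linarith
  rw [Real.exp_eq_one_iff] at this
  exact ht (by linarith)

lemma hasDerivAt_gg {t : ℝ} (ht : t ≠ 0) : HasDerivAt gg (gg t - gg t ^ 2) t := by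
  have h1 : HasDerivAt (fun s : ℝ => 1 - Real.exp (-s)) (Real.exp (-t)) t := by
    have := ((hasDerivAt_neg t).exp).const_sub 1
    simpa using this
  have h2 := h1.inv (den_ne ht)
  have hd := den_ne ht
  have : gg = (fun s : ℝ => 1 - Real.exp (-s))⁻¹ := by
    ext s; simp [gg]
  rw [this]
  have e : (1 - Real.exp (-t))⁻¹ - (1 - Real.exp (-t))⁻¹ ^ 2
      = -Real.exp (-t) / (1 - Real.exp (-t)) ^ 2 := by
    field_simp
    ring
  change HasDerivAt _ ((1 - Real.exp (-t))⁻¹ - (1 - Real.exp (-t))⁻¹ ^ 2) t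
  rw [e]
  exact h2

lemma contDiffAt_gg {t : ℝ} (ht : t ≠ 0) (n : WithTop ℕ∞) : ContDiffAt ℝ n gg t := by
  unfold gg
  have h : ContDiffAt ℝ n (fun s : ℝ => 1 - Real.exp (-s)) t := by fun_prop
  exact contDiffAt_const.div h (den_ne ht)

lemma hasDerivAt_iter {t : ℝ} (ht : t ≠ 0) (n : ℕ) :
    HasDerivAt (iteratedDeriv n gg) (iteratedDeriv (n + 1) gg t) t := by
  rw [iteratedDeriv_succ]
  apply DifferentiableAt.hasDerivAt
  rw [← iteratedDerivWithin_univ]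
  have h := ((contDiffAt_gg ht (n + 1 : ℕ)).contDiffWithinAt (s := Set.univ)).differentiableWithinAt_iteratedDerivWithin
    (m := n) (by exact_mod_cast Nat.lt_succ_self n) (by simpa using uniqueDiffOn_univ)
  exact differentiableWithinAt_univ.1 h

lemma gg_pow_eq (k : ℕ) : ∀ t : ℝ, t ≠ 0 → gg t ^ (k + 1) =
    ∑ j ∈ Finset.range (k + 1),
      ((-1 : ℝ) ^ j * (Nat.stirlingFirst (k + 1) (j + 1) : ℝ) / k.factorial) * iteratedDeriv j gg t := by
  induction k with
  | zero => intro t _; simp [Nat.stirlingFirst_self]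
  | succ k ih =>
    intro t ht
    have hL : HasDerivAt (fun s => gg s ^ (k + 1)) ((k + 1 : ℕ) * gg t ^ k * (gg t - gg t ^ 2)) t := by
      exact (hasDerivAt_gg ht).pow (k + 1)
    have hR : HasDerivAt (fun s => ∑ j ∈ Finset.range (k + 1),
      ((-1 : ℝ) ^ j * (Nat.stirlingFirst (k + 1) (j + 1) : ℝ) / k.factorial) * iteratedDeriv j gg s)
      (∑ j ∈ Finset.range (k + 1),
      ((-1 : ℝ) ^ j * (Nat.stirlingFirst (k + 1) (j + 1) : ℝ) / k.factorial) * iteratedDeriv (j + 1) gg t) t :=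
      HasDerivAt.fun_sum fun j _ => (hasDerivAt_iter ht j).const_mul _
    have hev : (fun s => gg s ^ (k + 1)) =ᶠ[nhds t] (fun s => ∑ j ∈ Finset.range (k + 1),
      ((-1 : ℝ) ^ j * (Nat.stirlingFirst (k + 1) (j + 1) : ℝ) / k.factorial) * iteratedDeriv j gg s) := by
      filter_upwards [isOpen_ne.mem_nhds ht] with s hs using ih s hs
    have hD := hL.unique (hR.congr_of_eventuallyEq hev)
    have hk : (k : ℝ) + 1 ≠ 0 := by positivity
    have hf : ((k.factorial : ℕ) : ℝ) ≠ 0 := by exact_mod_cast k.factorial_ne_zero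
    have hx : gg t ^ (k + 1 + 1) = gg t ^ (k + 1) - ((k + 1 : ℕ) * gg t ^ k * (gg t - gg t ^ 2)) / (k + 1) := by
      push_cast
      field_simp
      ring
    rw [hx, hD, ih t ht, Finset.sum_div]
    have e1 : ∑ j ∈ Finset.range (k + 1),
      ((-1 : ℝ) ^ j * (Nat.stirlingFirst (k + 1) (j + 1) : ℝ) / k.factorial) * iteratedDeriv j gg t
      = ∑ j ∈ Finset.range (k + 1 + 1),
      ((-1 : ℝ) ^ j * (Nat.stirlingFirst (k + 1) (j + 1) : ℝ) / k.factorial) * iteratedDeriv j gg t := by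
      rw [Finset.sum_range_succ _ (k + 1), Nat.stirlingFirst_eq_zero_of_lt (Nat.lt_succ_self (k + 1))]
      simp
    have e2 : ∑ j ∈ Finset.range (k + 1),
      ((-1 : ℝ) ^ j * (Nat.stirlingFirst (k + 1) (j + 1) : ℝ) / k.factorial) * iteratedDeriv (j + 1) gg t / (k + 1)
      = ∑ j ∈ Finset.range (k + 1 + 1),
      (-(-1 : ℝ) ^ j * (Nat.stirlingFirst (k + 1) j : ℝ) / k.factorial) * iteratedDeriv j gg t / (k + 1) := by
      rw [Finset.sum_range_succ' _ (k + 1)]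
      simp [pow_succ]
    rw [e1, e2, ← Finset.sum_sub_distrib]
    apply Finset.sum_congr rfl
    intro j _
    rw [Nat.stirlingFirst_succ_succ (k + 1) j, Nat.factorial_succ]
    push_cast
    field_simp
    ring

theorem one_div_one_sub_exp_neg_pow_eq' (k : ℕ) (hk : 1 ≤ k) (t : ℝ) (ht : t ≠ 0) :
    1 / (1 - Real.exp (-t)) ^ k =
      ∑ i ∈ Finset.Icc 1 k,
        (a k i : ℝ) * iteratedDeriv (i - 1) (fun s : ℝ => 1 / (1 - Real.exp (-s))) t := by
  obtain ⟨n, rfl⟩ : ∃ n, k = n + 1 := ⟨k - 1, by omega⟩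
  have h := gg_pow_eq n t ht
  have h0 : 1 / (1 - Real.exp (-t)) ^ (n + 1) = gg t ^ (n + 1) := by simp [gg]
  rw [h0, h]
  have hI : Finset.Icc 1 (n + 1) = Finset.Ico (0 + 1) (n + 1 + 1) := by ext; simp
  rw [hI, ← Finset.sum_Ico_add', ← Finset.range_eq_Ico]
  apply Finset.sum_congr rfl
  intro j hj
  have hj' : j < n + 1 := by simpa using hj
  rw [a, det_M (n + 1) (j + 1) (by omega) (by omega)]
  push_cast
  simp only [Nat.add_sub_cancel, pow_succ]
  change _ = _ * iteratedDeriv j gg t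
  ring
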